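/- For i = 1,…,k, let ℓᵢ(x,y) = q₁ⁱ·x + q₂ⁱ·y − tᵢ with (q₁ⁱ, q₂ⁱ) ∈ [0,1]² and tᵢ ≥ 0, and let u = max(0, ℓ₁, …, ℓ_k), which is a feasible utility function. Then R(u) ≤ k·BRev; i.e., the revenue of any mechanism with at most k non-zero menu items is at most k times the bundling revenue. -/

import Mathlib

open MeasureTheory Set

noncomputable section

/-- A positive, bounded, differentiable density on `[a,b]` integrating to 1. -/
def Density (a b : ℝ) (h : ℝ → ℝ) : Prop :=
  (∀ x ∈ Set.Icc a b, 0 < h x) ∧ (∃ M, ∀ x ∈ Set.Icc a b, h x ≤ M) ∧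
  (∀ x ∈ Set.Icc a b, DifferentiableAt ℝ h x) ∧ (∫ x in a..b, h x) = 1

/-- The valuation rectangle `V = [xA,xB] × [yA,yC]`. -/
def V (xA xB yA yC : ℝ) : Set (ℝ × ℝ) := Set.Icc (xA, yA) (xB, yC)

/-- First partial derivative. -/
def pd1 (u : ℝ × ℝ → ℝ) (z : ℝ × ℝ) : ℝ := fderiv ℝ u z (1, 0)

/-- Second partial derivative. -/
def pd2 (u : ℝ × ℝ → ℝ) (z : ℝ × ℝ) : ℝ := fderiv ℝ u z (0, 1)

/-- A feasible buyer utility function: nonnegative, convex, with increments in each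
coordinate between `0` and the coordinate increment (partial derivatives in `[0,1]`). -/
def Feasible (xA xB yA yC : ℝ) (u : ℝ × ℝ → ℝ) : Prop :=
  (∀ z ∈ V xA xB yA yC, 0 ≤ u z) ∧
  ConvexOn ℝ (V xA xB yA yC) u ∧
  (∀ x x' y, xA ≤ x → x ≤ x' → x' ≤ xB → y ∈ Set.Icc yA yC →
    0 ≤ u (x', y) - u (x, y) ∧ u (x', y) - u (x, y) ≤ x' - x) ∧
  (∀ x y y', x ∈ Set.Icc xA xB → yA ≤ y → y ≤ y' → y' ≤ yC →
    0 ≤ u (x, y') - u (x, y) ∧ u (x, y') - u (x, y) ≤ y' - y)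

/-- The seller's expected revenue from utility function `u` under joint density
`f₁(x)·f₂(y)`. -/
def Rev (xA xB yA yC : ℝ) (f1 f2 : ℝ → ℝ) (u : ℝ × ℝ → ℝ) : ℝ :=
  ∫ z in V xA xB yA yC, (z.1 * pd1 u z + z.2 * pd2 u z - u z) * (f1 z.1 * f2 z.2)

/-- The optimal revenue: supremum of revenue over feasible utility functions. -/
def OptRev (xA xB yA yC : ℝ) (f1 f2 : ℝ → ℝ) : ℝ :=
  sSup {r | ∃ u, Feasible xA xB yA yC u ∧ r = Rev xA xB yA yC f1 f2 u}

/-- A feasible utility function is optimal if its revenue attains the supremum. -/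
def Optimal (xA xB yA yC : ℝ) (f1 f2 : ℝ → ℝ) (u : ℝ × ℝ → ℝ) : Prop :=
  Feasible xA xB yA yC u ∧ Rev xA xB yA yC f1 f2 u = OptRev xA xB yA yC f1 f2

/-- The power rate of a density `h`: `PR(h)(x) = x·h'(x)/h(x)`. -/
def PR (h : ℝ → ℝ) (x : ℝ) : ℝ := x * deriv h x / h x

/-- The bundling revenue `BRev = sup_{p ≥ 0} p · ∫_{x+y ≥ p} f`. -/
def BRev (xA xB yA yC : ℝ) (f1 f2 : ℝ → ℝ) : ℝ :=
  sSup {r | ∃ p, 0 ≤ p ∧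
    r = p * ∫ z in {z ∈ V xA xB yA yC | p ≤ z.1 + z.2}, f1 z.1 * f2 z.2}

/-- The payment associated with utility `u` at a point of differentiability. -/
def pay (u : ℝ × ℝ → ℝ) (z : ℝ × ℝ) : ℝ := pd1 u z * z.1 + pd2 u z * z.2 - u z

/-- The utility induced by the menu `(q1 i, q2 i, t i)` together with the zero item. -/
def menuUtility {k : ℕ} (q1 q2 t : Fin k → ℝ) (z : ℝ × ℝ) : ℝ :=
  max 0 (⨆ i : Fin k, (q1 i * z.1 + q2 i * z.2 - t i))

section MenuUtility

variable {k : ℕ} {q1 q2 t : Fin k → ℝ}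

lemma menuUtility_nonneg (z : ℝ × ℝ) : 0 ≤ menuUtility q1 q2 t z := le_max_left _ _

lemma le_menuUtility (i : Fin k) (z : ℝ × ℝ) :
    q1 i * z.1 + q2 i * z.2 - t i ≤ menuUtility q1 q2 t z :=
  (le_ciSup (f := fun i : Fin k => q1 i * z.1 + q2 i * z.2 - t i)
    (Set.finite_range _).bddAbove i).trans (le_max_right _ _)

lemma menuUtility_le {z : ℝ × ℝ} {c : ℝ} (hc : 0 ≤ c)
    (h : ∀ i, q1 i * z.1 + q2 i * z.2 - t i ≤ c) : menuUtility q1 q2 t z ≤ c :=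
  max_le hc (Real.iSup_le h hc)

lemma menuUtility_eq_zero_or (z : ℝ × ℝ) :
    menuUtility q1 q2 t z = 0 ∨
      ∃ i, menuUtility q1 q2 t z = q1 i * z.1 + q2 i * z.2 - t i := by
  by_contra! h
  have hpos := lt_of_le_of_ne (menuUtility_nonneg (q1 := q1) (q2 := q2) (t := t) z) h.1.symm
  rcases isEmpty_or_nonempty (Fin k) with hk | hk
  · simp [menuUtility] at hpos
  · obtain ⟨i, hi⟩ := exists_eq_ciSup_of_finite
      (f := fun i : Fin k => q1 i * z.1 + q2 i * z.2 - t i)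
    rcases max_choice 0 (⨆ i : Fin k, (q1 i * z.1 + q2 i * z.2 - t i)) with h' | h'
    · exact h.1 h'
    · exact h.2 i (h'.trans hi.symm)

lemma feasible_menuUtility {xA xB yA yC : ℝ}
    (hq : ∀ i, q1 i ∈ Set.Icc (0 : ℝ) 1 ∧ q2 i ∈ Set.Icc (0 : ℝ) 1) :
    Feasible xA xB yA yC (menuUtility q1 q2 t) := by
  refine ⟨fun z _ => menuUtility_nonneg z, ⟨convex_Icc _ _, ?_⟩, ?_, ?_⟩
  · intro z _ w _ a b ha hb hab
    simp only [smul_eq_mul]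
    refine menuUtility_le ?_ fun i => ?_
    · have := menuUtility_nonneg (q1 := q1) (q2 := q2) (t := t) z
      have := menuUtility_nonneg (q1 := q1) (q2 := q2) (t := t) w
      positivity
    · have hz := mul_le_mul_of_nonneg_left (le_menuUtility (q1 := q1) (q2 := q2) (t := t) i z) ha
      have hw := mul_le_mul_of_nonneg_left (le_menuUtility (q1 := q1) (q2 := q2) (t := t) i w) hb
      have ht : t i = (a + b) * t i := by rw [hab, one_mul]
      simp only [Prod.fst_add, Prod.snd_add, Prod.smul_fst, Prod.smul_snd, smul_eq_mul]
      linarith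
  · intro x x' y _ hx _ _
    rw [sub_nonneg, sub_le_iff_le_add]
    refine ⟨menuUtility_le (menuUtility_nonneg _) fun i => ?_, menuUtility_le ?_ fun i => ?_⟩
    · have := mul_le_mul_of_nonneg_left hx (hq i).1.1
      have := le_menuUtility (q1 := q1) (q2 := q2) (t := t) i (x', y)
      simp only at *
      linarith
    · have := menuUtility_nonneg (q1 := q1) (q2 := q2) (t := t) (x, y)
      linarith
    · have := mul_le_mul_of_nonneg_right (hq i).1.2 (sub_nonneg.2 hx)
      have := le_menuUtility (q1 := q1) (q2 := q2) (t := t) i (x, y)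
      simp only at *
      linarith
  · intro x y y' _ _ hy _
    rw [sub_nonneg, sub_le_iff_le_add]
    refine ⟨menuUtility_le (menuUtility_nonneg _) fun i => ?_, menuUtility_le ?_ fun i => ?_⟩
    · have := mul_le_mul_of_nonneg_left hy (hq i).2.1
      have := le_menuUtility (q1 := q1) (q2 := q2) (t := t) i (x, y')
      simp only at *
      linarith
    · have := menuUtility_nonneg (q1 := q1) (q2 := q2) (t := t) (x, y)
      linarith
    · have := mul_le_mul_of_nonneg_right (hq i).2.2 (sub_nonneg.2 hy)
      have := le_menuUtility (q1 := q1) (q2 := q2) (t := t) i (x, y)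
      simp only at *
      linarith

/-- A function touched from below at `z` by an affine function has that function's gradient
at `z` if it is differentiable there. -/
lemma fderiv_apply_eq_of_affine_le {u : ℝ × ℝ → ℝ} {a b c : ℝ} {z : ℝ × ℝ}
    (hd : DifferentiableAt ℝ u z) (hle : ∀ w : ℝ × ℝ, a * w.1 + b * w.2 - c ≤ u w)
    (heq : u z = a * z.1 + b * z.2 - c) (v : ℝ × ℝ) :
    fderiv ℝ u z v = a * v.1 + b * v.2 := by
  have hl : HasFDerivAt (fun w : ℝ × ℝ => a * w.1 + b * w.2 - c)
      (a • ContinuousLinearMap.fst ℝ ℝ ℝ + b • ContinuousLinearMap.snd ℝ ℝ ℝ) z :=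
    ((hasFDerivAt_fst.const_mul a).add (hasFDerivAt_snd.const_mul b)).sub_const c
  have hmin : IsLocalMin (fun w => u w - (a * w.1 + b * w.2 - c)) z :=
    Filter.Eventually.of_forall fun w => by
      simp only [heq, sub_self, sub_nonneg]
      exact hle w
  have h := congrArg (fun L => L v) (hmin.hasFDerivAt_eq_zero (hd.hasFDerivAt.sub hl))
  simp at h
  linarith

/-- The payment collected at `z` is at most the sum of the prices of the menu items that the
bundle value at `z` could pay for. -/
lemma pay_menuUtility_le {z : ℝ × ℝ} (hz1 : 0 ≤ z.1) (hz2 : 0 ≤ z.2)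
    (hq : ∀ i, q1 i ∈ Set.Icc (0 : ℝ) 1 ∧ q2 i ∈ Set.Icc (0 : ℝ) 1 ∧ 0 ≤ t i) :
    z.1 * pd1 (menuUtility q1 q2 t) z + z.2 * pd2 (menuUtility q1 q2 t) z
        - menuUtility q1 q2 t z ≤
      ∑ i, {w : ℝ × ℝ | t i ≤ w.1 + w.2}.indicator (fun _ => t i) z := by
  have hterm : ∀ i ∈ Finset.univ,
      0 ≤ {w : ℝ × ℝ | t i ≤ w.1 + w.2}.indicator (fun _ => t i) z :=
    fun i _ => Set.indicator_nonneg (fun _ _ => (hq i).2.2) z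
  have hsum := Finset.sum_nonneg hterm
  have hu := menuUtility_nonneg (q1 := q1) (q2 := q2) (t := t) z
  unfold pd1 pd2
  by_cases hd : DifferentiableAt ℝ (menuUtility q1 q2 t) z
  · rcases menuUtility_eq_zero_or (q1 := q1) (q2 := q2) (t := t) z with h | ⟨i, hi⟩
    · have hg := fderiv_apply_eq_of_affine_le (a := 0) (b := 0) (c := 0) hd
        (fun w => by simpa using menuUtility_nonneg w) (by simpa using h)
      rw [hg, hg, h]
      simpa using hsum
    · have hg := fderiv_apply_eq_of_affine_le hd (le_menuUtility i) hi
      have hmem : z ∈ {w : ℝ × ℝ | t i ≤ w.1 + w.2} := by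
        have := mul_le_mul_of_nonneg_right (hq i).1.2 hz1
        have := mul_le_mul_of_nonneg_right (hq i).2.1.2 hz2
        simp only [Set.mem_ofPred_eq]
        linarith
      have hsingle := Finset.single_le_sum hterm (Finset.mem_univ i)
      rw [Set.indicator_of_mem hmem] at hsingle
      rw [hg, hg, hi]
      refine le_trans (le_of_eq ?_) hsingle
      ring
  · rw [fderiv_zero_of_not_differentiableAt hd]
    simp only [zero_apply, mul_zero, zero_add, zero_sub]
    linarith

end MenuUtility

section BundlingRevenue

variable {xA xB yA yC : ℝ} {f1 f2 : ℝ → ℝ}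

lemma Density.continuousOn {a b : ℝ} {h : ℝ → ℝ} (hh : Density a b h) :
    ContinuousOn h (Set.Icc a b) :=
  fun x hx => (hh.2.2.1 x hx).continuousAt.continuousWithinAt

lemma mem_V {z : ℝ × ℝ} : z ∈ V xA xB yA yC ↔ z.1 ∈ Set.Icc xA xB ∧ z.2 ∈ Set.Icc yA yC := by
  simp only [V, Set.mem_Icc, Prod.le_def]
  tauto

lemma measurableSet_V : MeasurableSet (V xA xB yA yC) := measurableSet_Icc

lemma measurableSet_le_fst_add_snd (p : ℝ) : MeasurableSet {z : ℝ × ℝ | p ≤ z.1 + z.2} :=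
  measurableSet_le measurable_const (measurable_fst.add measurable_snd)

lemma integrableOn_density_mul (hf1 : Density xA xB f1) (hf2 : Density yA yC f2) :
    IntegrableOn (fun z : ℝ × ℝ => f1 z.1 * f2 z.2) (V xA xB yA yC) :=
  ContinuousOn.integrableOn_compact isCompact_Icc <|
    (hf1.continuousOn.comp continuousOn_fst fun _ hz => (mem_V.1 hz).1).mul
      (hf2.continuousOn.comp continuousOn_snd fun _ hz => (mem_V.1 hz).2)

lemma density_mul_nonneg (hf1 : Density xA xB f1) (hf2 : Density yA yC f2) {z : ℝ × ℝ}
    (hz : z ∈ V xA xB yA yC) : 0 ≤ f1 z.1 * f2 z.2 :=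
  mul_nonneg (hf1.1 _ (mem_V.1 hz).1).le (hf2.1 _ (mem_V.1 hz).2).le

lemma mul_integral_le_BRev (hf1 : Density xA xB f1) (hf2 : Density yA yC f2) {p : ℝ}
    (hp : 0 ≤ p) :
    p * ∫ z in {z ∈ V xA xB yA yC | p ≤ z.1 + z.2}, f1 z.1 * f2 z.2 ≤
      BRev xA xB yA yC f1 f2 := by
  refine le_csSup ⟨max 0 (xB + yC) * ∫ z in V xA xB yA yC, f1 z.1 * f2 z.2, ?_⟩ ⟨p, hp, rfl⟩
  rintro _ ⟨r, hr, rfl⟩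
  have hV : 0 ≤ ∫ z in V xA xB yA yC, f1 z.1 * f2 z.2 :=
    setIntegral_nonneg measurableSet_V fun z hz => density_mul_nonneg hf1 hf2 hz
  rcases le_or_gt r (xB + yC) with h | h
  · have hsub : ∫ z in {z ∈ V xA xB yA yC | r ≤ z.1 + z.2}, f1 z.1 * f2 z.2 ≤
        ∫ z in V xA xB yA yC, f1 z.1 * f2 z.2 := by
      refine setIntegral_mono_set (integrableOn_density_mul hf1 hf2) ?_
        (Filter.Eventually.of_forall fun z hz => hz.1)
      filter_upwards [ae_restrict_mem measurableSet_V] with z hz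
      exact density_mul_nonneg hf1 hf2 hz
    exact (mul_le_mul_of_nonneg_left hsub hr).trans
      (mul_le_mul_of_nonneg_right (h.trans (le_max_right _ _)) hV)
  · have hempty : {z ∈ V xA xB yA yC | r ≤ z.1 + z.2} = ∅ := by
      ext z
      simp only [Set.mem_ofPred_eq, Set.mem_empty_iff_false, iff_false, not_and, not_le]
      intro hz
      linarith [(mem_V.1 hz).1.2, (mem_V.1 hz).2.2]
    rw [hempty]
    simp only [Measure.restrict_empty, integral_zero_measure, mul_zero]
    positivity

lemma indicator_const_mul_eq (s : Set (ℝ × ℝ)) (p : ℝ) (f : ℝ × ℝ → ℝ) :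
    (fun z => s.indicator (fun _ => p) z * f z) = s.indicator fun z => p * f z :=
  funext fun _ => (Set.indicator_mul_left s (fun _ => p) f).symm

lemma integral_indicator_mul_le_BRev (hf1 : Density xA xB f1) (hf2 : Density yA yC f2) {p : ℝ}
    (hp : 0 ≤ p) :
    ∫ z in V xA xB yA yC,
        {w : ℝ × ℝ | p ≤ w.1 + w.2}.indicator (fun _ => p) z * (f1 z.1 * f2 z.2) ≤
      BRev xA xB yA yC f1 f2 := by
  refine le_trans (le_of_eq ?_) (mul_integral_le_BRev hf1 hf2 hp)
  rw [indicator_const_mul_eq]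
  rw [setIntegral_indicator (measurableSet_le_fst_add_snd p), integral_const_mul]
  rfl

lemma integrableOn_indicator_mul (hf1 : Density xA xB f1) (hf2 : Density yA yC f2) (p : ℝ) :
    IntegrableOn (fun z : ℝ × ℝ =>
      {w : ℝ × ℝ | p ≤ w.1 + w.2}.indicator (fun _ => p) z * (f1 z.1 * f2 z.2))
      (V xA xB yA yC) := by
  rw [indicator_const_mul_eq]
  exact ((integrableOn_density_mul hf1 hf2).const_mul p).indicator
    (measurableSet_le_fst_add_snd p)

lemma Rev_menuUtility_le (h0 : 0 ≤ xA) (h2 : 0 ≤ yA) (hf1 : Density xA xB f1)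
    (hf2 : Density yA yC f2) {k : ℕ} {q1 q2 t : Fin k → ℝ}
    (hq : ∀ i, q1 i ∈ Set.Icc (0 : ℝ) 1 ∧ q2 i ∈ Set.Icc (0 : ℝ) 1 ∧ 0 ≤ t i) :
    Rev xA xB yA yC f1 f2 (menuUtility q1 q2 t) ≤ k * BRev xA xB yA yC f1 f2 := by
  unfold Rev
  by_cases hRint : IntegrableOn (fun z : ℝ × ℝ => (z.1 * pd1 (menuUtility q1 q2 t) z +
      z.2 * pd2 (menuUtility q1 q2 t) z - menuUtility q1 q2 t z) * (f1 z.1 * f2 z.2))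
      (V xA xB yA yC)
  · calc
      _ ≤ ∫ z in V xA xB yA yC, ∑ i,
            {w : ℝ × ℝ | t i ≤ w.1 + w.2}.indicator (fun _ => t i) z * (f1 z.1 * f2 z.2) := by
          refine setIntegral_mono_on hRint
            (integrable_finsetSum _ fun i _ => integrableOn_indicator_mul hf1 hf2 (t i))
            measurableSet_V fun z hz => ?_
          rw [← Finset.sum_mul]
          exact mul_le_mul_of_nonneg_right
            (pay_menuUtility_le (h0.trans (mem_V.1 hz).1.1) (h2.trans (mem_V.1 hz).2.1) hq)
            (density_mul_nonneg hf1 hf2 hz)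
      _ = ∑ i, ∫ z in V xA xB yA yC,
            {w : ℝ × ℝ | t i ≤ w.1 + w.2}.indicator (fun _ => t i) z * (f1 z.1 * f2 z.2) :=
          integral_finsetSum _ fun i _ => integrableOn_indicator_mul hf1 hf2 (t i)
      _ ≤ ∑ _i : Fin k, BRev xA xB yA yC f1 f2 :=
          Finset.sum_le_sum fun i _ => integral_indicator_mul_le_BRev hf1 hf2 (hq i).2.2
      _ = k * BRev xA xB yA yC f1 f2 := by simp
  · rw [integral_undef hRint]
    have hB := mul_integral_le_BRev hf1 hf2 le_rfl
    rw [zero_mul] at hB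
    positivity

end BundlingRevenue

/-- the utility induced by `k` non-zero linear menu items (with
allocations in `[0,1]²` and nonnegative payments) together with the zero item is a
feasible utility function whose revenue is at most `k` times the bundling revenue. -/
theorem stmt19 (xA xB yA yC : ℝ) (h0 : 0 ≤ xA) (h1 : xA < xB) (h2 : 0 ≤ yA) (h3 : yA < yC)
    (f1 f2 : ℝ → ℝ) (hf1 : Density xA xB f1) (hf2 : Density yA yC f2)
    (k : ℕ) (q1 q2 t : Fin k → ℝ)
    (hq : ∀ i, q1 i ∈ Set.Icc (0:ℝ) 1 ∧ q2 i ∈ Set.Icc (0:ℝ) 1 ∧ 0 ≤ t i) :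
    Feasible xA xB yA yC
      (fun z => max 0 (⨆ i : Fin k, (q1 i * z.1 + q2 i * z.2 - t i))) ∧
    Rev xA xB yA yC f1 f2
      (fun z => max 0 (⨆ i : Fin k, (q1 i * z.1 + q2 i * z.2 - t i))) ≤
      k * BRev xA xB yA yC f1 f2 := by
  exact ⟨feasible_menuUtility fun i => ⟨(hq i).1, (hq i).2.1⟩,
    Rev_menuUtility_le h0 h2 hf1 hf2 hq⟩
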